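/- arXiv:0801.2334 — 5 statements merged into one kernel-verified Lean document; each statement's English description precedes it below -/
import Mathlib

section
/- Regard P₀, P₁, P₂, … as multivariate polynomials over ℂ in the variables c₁, c₂, …, defined by P₀ = 1 and P_n = −Σ_{j=1}^{n} (j+1)·c_j·P_{n−j}. For k ≥ 1 let the Kirillov operator L_k act on polynomials by L_k Q = ∂Q/∂c_k + Σ_{j≥1} (j+1)·c_j·∂Q/∂c_{k+j} (a finite sum on any polynomial). Then for all n ≥ 0 and k ≥ 1: L_k P_n = (n − 2k − 1)·P_{n−k} if n ≥ k, and L_k P_n = 0 if n < k. -/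
open Finset MvPolynomial

/-- A sum supported on the indices `j ≥ k`, shifted by `k`, with its first term split off. -/
lemma sum_Icc_ite_shift {M : Type*} [AddCommMonoid M] (g : ℕ → M) {k : ℕ} (hk : 1 ≤ k) (m : ℕ) :
    ∑ j ∈ Icc 1 (k + m), (if k ≤ j then g (j - k) else 0) = g 0 + ∑ i ∈ Icc 1 m, g i := by
  have hsplit : g 0 + ∑ i ∈ Icc 1 m, g i = ∑ i ∈ Icc 0 m, g i := by
    rw [← Finset.insert_Icc_add_one_left_eq_Icc (Nat.zero_le m), Finset.sum_insert (by simp)]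
    simp
  rw [hsplit, ← Finset.sum_filter]
  refine Finset.sum_nbij' (fun j => j - k) (fun i => i + k) ?_ ?_ ?_ ?_ fun _ _ => rfl <;>
    simp only [mem_filter, mem_Icc] <;> intros <;> omega

lemma sum_Icc_ite_le_sub {M : Type*} [AddCommMonoid M] (h : ℕ → M) (k m : ℕ) :
    ∑ j ∈ Icc 1 (k + m), (if k ≤ k + m - j then h j else 0) = ∑ j ∈ Icc 1 m, h j := by
  rw [← Finset.sum_filter]
  refine Finset.sum_congr ?_ fun _ _ => rfl
  ext j
  simp only [mem_filter, mem_Icc]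
  omega

/-- The Kirillov operator `L_k` with its sum truncated at `j = N`, as a derivation. -/
noncomputable def truncatedKirillov (k N : ℕ) :
    Derivation ℂ (MvPolynomial ℕ ℂ) (MvPolynomial ℕ ℂ) :=
  pderiv k + ∑ j ∈ Icc 1 N, (C ((j : ℂ) + 1) * X j : MvPolynomial ℕ ℂ) • pderiv (k + j)

lemma truncatedKirillov_apply (k N : ℕ) (Q : MvPolynomial ℕ ℂ) :
    truncatedKirillov k N Q =
      pderiv k Q + ∑ j ∈ Icc 1 N, C ((j : ℂ) + 1) * X j * pderiv (k + j) Q := by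
  have hsum := congrFun (map_sum (Derivation.coeFnAddMonoidHom
    (R := ℂ) (A := MvPolynomial ℕ ℂ) (M := MvPolynomial ℕ ℂ))
    (fun j : ℕ => (C ((j : ℂ) + 1) * X j : MvPolynomial ℕ ℂ) • pderiv (k + j)) (Icc 1 N)) Q
  simp only [Derivation.coeFnAddMonoidHom_apply, Finset.sum_apply, Derivation.smul_apply,
    smul_eq_mul] at hsum
  rw [truncatedKirillov, Derivation.add_apply, hsum]

lemma truncatedKirillov_X {k N m : ℕ} (hm : m ≤ N) :
    truncatedKirillov k N (X m) =
      if k ≤ m then (if m - k = 0 then 1 else C (((m - k : ℕ) : ℂ) + 1) * X (m - k)) else 0 := by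
  rw [truncatedKirillov_apply]
  simp only [pderiv_X, Pi.single_apply, mul_ite, mul_one, mul_zero]
  by_cases hkm : k ≤ m
  · obtain ⟨i, rfl⟩ := Nat.exists_eq_add_of_le hkm
    simp only [Nat.add_left_cancel_iff, Finset.sum_ite_eq, mem_Icc, Nat.add_sub_cancel_left,
      Nat.le_add_right, if_true]
    rcases Nat.eq_zero_or_pos i with rfl | hi
    · simp
    · rw [if_neg (by omega), if_pos (by omega), if_neg (by omega), zero_add]
  · rw [if_neg (by omega), if_neg hkm, zero_add]
    exact Finset.sum_eq_zero fun j _ => if_neg (by omega)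

lemma truncatedKirillov_eq {P : ℕ → MvPolynomial ℕ ℂ} (hP0 : P 0 = 1)
    (hP : ∀ n : ℕ, 1 ≤ n →
      P n = -∑ j ∈ Icc 1 n, C ((j : ℂ) + 1) * X j * P (n - j))
    {k N : ℕ} (hk : 1 ≤ k) {n : ℕ} (hn : n ≤ N) :
    truncatedKirillov k N (P n) =
      if k ≤ n then C ((n : ℂ) - 2 * (k : ℂ) - 1) * P (n - k) else 0 := by
  induction n using Nat.strong_induction_on with
  | _ n ih =>
  rcases Nat.eq_zero_or_pos n with rfl | hpos
  · rw [hP0, Derivation.map_one_eq_zero, if_neg (by omega)]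
  have hterm : ∀ j ∈ Icc 1 n, truncatedKirillov k N (C ((j : ℂ) + 1) * X j * P (n - j)) =
      (if k ≤ n - j then C ((j : ℂ) + 1) * X j *
        (C (((n - j : ℕ) : ℂ) - 2 * (k : ℂ) - 1) * P (n - j - k)) else 0) +
      (if k ≤ j then C ((j : ℂ) + 1) * P (n - j) *
        (if j - k = 0 then 1 else C (((j - k : ℕ) : ℂ) + 1) * X (j - k)) else 0) := by
    intro j hj
    rw [mem_Icc] at hj
    have hC : truncatedKirillov k N (C ((j : ℂ) + 1)) = 0 :=
      Derivation.map_algebraMap _ _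
    rw [Derivation.leibniz, Derivation.leibniz, hC, ih (n - j) (by omega) (by omega),
      truncatedKirillov_X (by omega)]
    simp only [smul_eq_mul, mul_ite, mul_zero, add_zero]
    split_ifs <;> ring
  rw [hP n hpos, map_neg, map_sum, Finset.sum_congr rfl hterm, Finset.sum_add_distrib]
  by_cases hkn : k ≤ n
  · obtain ⟨m, rfl⟩ := Nat.exists_eq_add_of_le hkn
    have hshift : ∑ j ∈ Icc 1 (k + m), (if k ≤ j then C ((j : ℂ) + 1) * P (k + m - j) *
          (if j - k = 0 then 1 else C (((j - k : ℕ) : ℂ) + 1) * X (j - k)) else 0) =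
        C ((k : ℂ) + 1) * P m + ∑ i ∈ Icc 1 m,
          C ((i : ℂ) + k + 1) * P (m - i) * (C ((i : ℂ) + 1) * X i) := by
      have key := sum_Icc_ite_shift (fun i => C ((i : ℂ) + k + 1) * P (m - i) *
        (if i = 0 then 1 else C ((i : ℂ) + 1) * X i)) hk m
      simp only [Nat.cast_zero, zero_add, Nat.sub_zero, if_true, mul_one] at key
      refine Eq.trans (Finset.sum_congr rfl fun j _ => ?_)
        (key.trans (congrArg _ (Finset.sum_congr rfl fun i hi => ?_)))
      · split_ifs with h1 h2
        · rw [show k + m - j = m - (j - k) by omega, Nat.cast_sub h1, sub_add_cancel]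
        · rw [show k + m - j = m - (j - k) by omega, Nat.cast_sub h1, sub_add_cancel]
        · rfl
      · rw [mem_Icc] at hi
        rw [if_neg (by omega)]
    have hrec : (C (m : ℂ) : MvPolynomial ℕ ℂ) * P m =
        -∑ i ∈ Icc 1 m, C (m : ℂ) * (C ((i : ℂ) + 1) * X i * P (m - i)) := by
      rcases Nat.eq_zero_or_pos m with rfl | hm
      · simp
      · rw [← Finset.mul_sum, ← mul_neg, ← hP m hm]
    have hcombine : ∑ j ∈ Icc 1 m, C ((j : ℂ) + 1) * X j *
          (C (((k + m - j : ℕ) : ℂ) - 2 * (k : ℂ) - 1) * P (k + m - j - k)) +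
        ∑ i ∈ Icc 1 m, C ((i : ℂ) + k + 1) * P (m - i) * (C ((i : ℂ) + 1) * X i) =
        ∑ i ∈ Icc 1 m, C (m : ℂ) * (C ((i : ℂ) + 1) * X i * P (m - i)) := by
      rw [← Finset.sum_add_distrib]
      refine Finset.sum_congr rfl fun i hi => ?_
      rw [mem_Icc] at hi
      rw [show k + m - i - k = m - i by omega, Nat.cast_sub (by omega)]
      simp only [C_add, C_sub, C_mul, Nat.cast_add]
      simp only [C_1, map_ofNat]
      ring
    rw [sum_Icc_ite_le_sub, hshift, if_pos hkn, Nat.add_sub_cancel_left]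
    have hC : (C (((k + m : ℕ) : ℂ) - 2 * (k : ℂ) - 1) : MvPolynomial ℕ ℂ) =
        C (m : ℂ) - C ((k : ℂ) + 1) := by
      rw [← C_sub]
      congr 1
      push_cast
      ring
    rw [hC, sub_mul, hrec, ← hcombine]
    ring
  · rw [if_neg hkn, Finset.sum_eq_zero, Finset.sum_eq_zero, add_zero, neg_zero]
    · intro j hj
      rw [mem_Icc] at hj
      exact if_neg (by omega)
    · intro j _
      exact if_neg (by omega)

/-- **Action of the Kirillov operators on the polynomials `P_n`.**
The `P_n` are multivariate polynomials in the variables `c_1, c_2, …`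
(the variable of index `j ≥ 1` being `c_j`), defined by `P₀ = 1` and
`P_n = −Σ_{j=1}^{n} (j+1)·c_j·P_{n−j}`.  The Kirillov operator
`L_k Q = ∂Q/∂c_k + Σ_{j≥1} (j+1)·c_j·∂Q/∂c_{k+j}` (truncated at `j = n`, which
is harmless since `P_n` only involves `c_1, …, c_n`) satisfies
`L_k P_n = (n − 2k − 1)·P_{n−k}` when `n ≥ k` and `L_k P_n = 0` when `n < k`. -/
theorem kirillov_action_on_P
    (P : ℕ → MvPolynomial ℕ ℂ)
    (hP0 : P 0 = 1)
    (hP : ∀ n : ℕ, 1 ≤ n →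
      P n = -∑ j ∈ Icc 1 n, C ((j : ℂ) + 1) * X j * P (n - j)) :
    ∀ n k : ℕ, 1 ≤ k →
      (k ≤ n →
        pderiv k (P n) + ∑ j ∈ Icc 1 n, C ((j : ℂ) + 1) * X j * pderiv (k + j) (P n)
          = C ((n : ℂ) - 2 * (k : ℂ) - 1) * P (n - k)) ∧
      (n < k →
        pderiv k (P n) + ∑ j ∈ Icc 1 n, C ((j : ℂ) + 1) * X j * pderiv (k + j) (P n)
          = 0) := by
  intro n k hk
  simp only [← truncatedKirillov_apply, truncatedKirillov_eq hP0 hP hk le_rfl]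
  exact ⟨fun h => if_pos h, fun h => if_neg (by omega)⟩
end

section
/- Fix n ≥ 1 and let c₁, …, c_n, ψ̄₁, …, ψ̄_n : ℝ → ℂ be differentiable functions. Define l_k(t) = ψ̄_k(t) + Σ_{j=1}^{n−k} (j+1)·c_j(t)·ψ̄_{k+j}(t) for k = 1, …, n. Assume the Hamiltonian equations hold for all t: ċ_k = conj(l_k) + Σ_{j=1}^{k−1} (j+1)·c_j·conj(l_{k−j}) for k = 1, …, n, and ψ̄̇_p = −(p+1)·Σ_{k=1}^{n−p} conj(l_k)·ψ̄_{k+p} for p = 1, …, n. Then the functions l_k satisfy l̇_k(t) = Σ_{j=1}^{n−k} (j − k)·conj(l_j(t))·l_{j+k}(t) for all k = 1, …, n and all t. -/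
open Finset

/-- The component `l_k = ψ̄_k + Σ_{j=1}^{n−k} (j+1)·c_j·ψ̄_{k+j}` of the Hamiltonian
`H = Σ |l_k|²` built from the truncated Kirillov fields on the coefficient body. -/
noncomputable def lComp (n : ℕ) (c ψ : ℕ → ℝ → ℂ) (k : ℕ) (t : ℝ) : ℂ :=
  ψ k t + ∑ j ∈ Icc 1 (n - k), ((j : ℂ) + 1) * c j t * ψ (k + j) t

/-- Reindexing of a sum over pairs of positive integers with sum at most `N`, by their sum. -/
lemma sum_Icc_sum_Icc_sub_one {M : Type*} [AddCommMonoid M] (N : ℕ) (f : ℕ → ℕ → M) :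
    ∑ j ∈ Icc 1 N, ∑ i ∈ Icc 1 (j - 1), f i (j - i) =
      ∑ m ∈ Icc 1 N, ∑ i ∈ Icc 1 (N - m), f i m := by
  rw [sum_sigma', sum_sigma']
  refine sum_bij' (fun p _ => ⟨p.1 - p.2, p.2⟩) (fun p _ => ⟨p.1 + p.2, p.2⟩) ?_ ?_ ?_ ?_ ?_
  · rintro ⟨j, i⟩ h
    simp only [mem_sigma, mem_Icc] at h ⊢
    omega
  · rintro ⟨m, i⟩ h
    simp only [mem_sigma, mem_Icc] at h ⊢
    omega
  · rintro ⟨j, i⟩ h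
    simp only [mem_sigma, mem_Icc] at h
    simp only [Sigma.mk.injEq, heq_eq_eq, and_true]
    omega
  · rintro ⟨m, i⟩ h
    simp
  · rintro ⟨j, i⟩ h
    rfl

/-- Exchange of summation order over pairs of positive integers with sum at most `N`. -/
lemma sum_Icc_sum_Icc_sub_comm {M : Type*} [AddCommMonoid M] (N : ℕ) (f : ℕ → ℕ → M) :
    ∑ i ∈ Icc 1 N, ∑ m ∈ Icc 1 (N - i), f i m =
      ∑ m ∈ Icc 1 N, ∑ i ∈ Icc 1 (N - m), f i m := by
  refine sum_comm' fun i m => ?_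
  simp only [mem_Icc]
  omega

/-- The algebraic identity behind the evolution of `l_k`, with `a j` in place of `conj l_j`. -/
lemma evolution_identity (N k : ℕ) (a c ψ : ℕ → ℂ) :
    -((k : ℂ) + 1) * ∑ m ∈ Icc 1 N, a m * ψ (m + k) +
      ∑ j ∈ Icc 1 N,
        (((j : ℂ) + 1) * (a j + ∑ i ∈ Icc 1 (j - 1), ((i : ℂ) + 1) * c i * a (j - i)) *
            ψ (k + j) +
          ((j : ℂ) + 1) * c j *
            (-(((k + j : ℕ) : ℂ) + 1) * ∑ m ∈ Icc 1 (N - j), a m * ψ (m + (k + j)))) =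
    ∑ j ∈ Icc 1 N, ((j : ℂ) - k) * a j *
      (ψ (j + k) + ∑ i ∈ Icc 1 (N - j), ((i : ℂ) + 1) * c i * ψ (j + k + i)) := by
  have h_pos : ∑ j ∈ Icc 1 N, ((j : ℂ) + 1) *
        (∑ i ∈ Icc 1 (j - 1), ((i : ℂ) + 1) * c i * a (j - i)) * ψ (k + j) =
      ∑ m ∈ Icc 1 N, ∑ i ∈ Icc 1 (N - m),
        ((i : ℂ) + m + 1) * (((i : ℂ) + 1) * c i * a m) * ψ (m + k + i) := by
    rw [← sum_Icc_sum_Icc_sub_one N fun i m =>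
      ((i : ℂ) + m + 1) * (((i : ℂ) + 1) * c i * a m) * ψ (m + k + i)]
    refine sum_congr rfl fun j _ => ?_
    rw [mul_sum, sum_mul]
    refine sum_congr rfl fun i hi => ?_
    rw [mem_Icc] at hi
    rw [Nat.cast_sub (by omega : i ≤ j), show j - i + k + i = k + j by omega]
    ring
  have h_mom : ∑ j ∈ Icc 1 N, ((j : ℂ) + 1) * c j *
        (-(((k + j : ℕ) : ℂ) + 1) * ∑ m ∈ Icc 1 (N - j), a m * ψ (m + (k + j))) =
      ∑ m ∈ Icc 1 N, ∑ i ∈ Icc 1 (N - m),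
        ((i : ℂ) + 1) * c i * (-((k : ℂ) + i + 1) * (a m * ψ (m + k + i))) := by
    rw [← sum_Icc_sum_Icc_sub_comm]
    refine sum_congr rfl fun j _ => ?_
    rw [mul_sum, mul_sum]
    refine sum_congr rfl fun m _ => ?_
    rw [Nat.cast_add, add_assoc m k j]
  simp only [mul_add _ (a _), add_mul _ _ (ψ _), sum_add_distrib]
  rw [h_pos, h_mom, mul_sum, ← sum_add_distrib, ← sum_add_distrib, ← sum_add_distrib]
  refine sum_congr rfl fun m _ => ?_
  rw [add_assoc, ← sum_add_distrib, ← add_assoc, mul_add, mul_sum, add_comm k m]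
  congr 1
  · ring
  · exact sum_congr rfl fun i _ => by ring

/-- **The `l_k` satisfy `l̇_k = Σ_{j=1}^{n−k} (j − k)·l̄_j·l_{j+k}` along the Hamiltonian flow.**
Assuming the Hamiltonian equations `ċ_k = l̄_k + Σ_{j=1}^{k−1} (j+1)·c_j·l̄_{k−j}` and
`ψ̄̇_p = −(p+1)·Σ_{k=1}^{n−p} l̄_k·ψ̄_{k+p}`. -/
theorem lComp_evolution
    (n : ℕ) (hn : 1 ≤ n) (c ψ : ℕ → ℝ → ℂ)
    (hc : ∀ k : ℕ, 1 ≤ k → k ≤ n → ∀ t : ℝ,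
      HasDerivAt (c k)
        ((starRingEnd ℂ) (lComp n c ψ k t) +
          ∑ j ∈ Icc 1 (k - 1), ((j : ℂ) + 1) * c j t * (starRingEnd ℂ) (lComp n c ψ (k - j) t))
        t)
    (hψ : ∀ p : ℕ, 1 ≤ p → p ≤ n → ∀ t : ℝ,
      HasDerivAt (ψ p)
        (-((p : ℂ) + 1) * ∑ k ∈ Icc 1 (n - p), (starRingEnd ℂ) (lComp n c ψ k t) * ψ (k + p) t)
        t) :
    ∀ k : ℕ, 1 ≤ k → k ≤ n → ∀ t : ℝ,
      HasDerivAt (lComp n c ψ k)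
        (∑ j ∈ Icc 1 (n - k), ((j : ℂ) - (k : ℂ)) * (starRingEnd ℂ) (lComp n c ψ j t) *
          lComp n c ψ (j + k) t)
        t := by
  intro k hk hkn t
  have h := (hψ k hk hkn t).add <| HasDerivAt.fun_sum (u := Icc 1 (n - k)) fun j hj => by
    rw [mem_Icc] at hj
    exact ((hc j hj.1 (by omega) t).const_mul ((j : ℂ) + 1)).mul
      (hψ (k + j) (by omega) (by omega) t)
  refine h.congr_deriv ?_
  have h_id := evolution_identity (n - k) k (fun j => (starRingEnd ℂ) (lComp n c ψ j t))
    (fun j => c j t) (fun j => ψ j t)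
  simp only [Nat.sub_sub, add_comm _ k] at h_id
  simpa only [lComp, Nat.sub_sub, add_comm _ k] using h_id
end

section
/- Fix n ≥ 1 and let c₁, …, c_n, ψ̄₁, …, ψ̄_n ∈ ℂ. Define l_k = ψ̄_k + Σ_{j=1}^{n−k} (j+1)·c_j·ψ̄_{k+j} for k = 1, …, n, and define v_k = conj(l_k) + Σ_{j=1}^{k−1} (j+1)·c_j·conj(l_{k−j}) (the right-hand sides of the Hamiltonian position equations ċ_k). Then the canonical pairing equals the Hamiltonian: Σ_{k=1}^{n} ψ̄_k·v_k = Σ_{k=1}^{n} l_k·conj(l_k), so that the Legendre transform yields the Lagrangian 𝓛 = (1/2)·Σ_{k=1}^{n} |u_k|². -/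
open Finset

/-- Reindexing of a sum over the triangle `1 ≤ j < k ≤ n` by the pairs `(k - j, j)`. -/
theorem sum_Icc_sum_Icc_sub_one_eq {M : Type*} [AddCommMonoid M] (n : ℕ) (f : ℕ → ℕ → M) :
    ∑ k ∈ Icc 1 n, ∑ j ∈ Icc 1 (k - 1), f (k - j) j =
      ∑ k ∈ Icc 1 n, ∑ j ∈ Icc 1 (n - k), f k j := by
  rw [sum_sigma', sum_sigma']
  refine sum_bij' (fun x _ => ⟨x.1 - x.2, x.2⟩) (fun x _ => ⟨x.1 + x.2, x.2⟩) ?_ ?_ ?_ ?_ ?_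
  · rintro ⟨k, j⟩ h
    simp only [mem_sigma, mem_Icc] at h ⊢
    omega
  · rintro ⟨k, j⟩ h
    simp only [mem_sigma, mem_Icc] at h ⊢
    omega
  · rintro ⟨k, j⟩ h
    simp only [mem_sigma, mem_Icc] at h
    simp only [Sigma.mk.injEq, heq_eq_eq, and_true]
    omega
  · rintro ⟨k, j⟩ _
    simp
  · rintro ⟨k, j⟩ _
    rfl

/-- **The canonical pairing equals the Hamiltonian** (so the Legendre transform yields the
Lagrangian `𝓛 = ½·Σ|u_k|²`).  With `l_k = ψ̄_k + Σ_{j=1}^{n−k} (j+1)·c_j·ψ̄_{k+j}` and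
`v_k = l̄_k + Σ_{j=1}^{k−1} (j+1)·c_j·l̄_{k−j}` (the Hamiltonian velocities `ċ_k`),
one has `Σ_{k=1}^{n} ψ̄_k·v_k = Σ_{k=1}^{n} l_k·l̄_k`. -/
theorem pairing_eq_hamiltonian
    (n : ℕ) (hn : 1 ≤ n) (c ψ : ℕ → ℂ)
    (l : ℕ → ℂ)
    (hl : ∀ k : ℕ, l k = ψ k + ∑ j ∈ Icc 1 (n - k), ((j : ℂ) + 1) * c j * ψ (k + j))
    (v : ℕ → ℂ)
    (hv : ∀ k : ℕ, v k = (starRingEnd ℂ) (l k) +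
      ∑ j ∈ Icc 1 (k - 1), ((j : ℂ) + 1) * c j * (starRingEnd ℂ) (l (k - j))) :
    ∑ k ∈ Icc 1 n, ψ k * v k = ∑ k ∈ Icc 1 n, l k * (starRingEnd ℂ) (l k) := by
  have hψv : ∀ k ∈ Icc 1 n, ψ k * v k = ψ k * (starRingEnd ℂ) (l k) +
      ∑ j ∈ Icc 1 (k - 1),
        ((j : ℂ) + 1) * c j * ψ (k - j + j) * (starRingEnd ℂ) (l (k - j)) := by
    intro k _
    rw [hv, mul_add, mul_sum]
    congr 1
    refine sum_congr rfl fun j hj => ?_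
    rw [mem_Icc] at hj
    rw [Nat.sub_add_cancel (by omega)]
    ring
  have hll : ∀ k ∈ Icc 1 n, l k * (starRingEnd ℂ) (l k) = ψ k * (starRingEnd ℂ) (l k) +
      ∑ j ∈ Icc 1 (n - k), ((j : ℂ) + 1) * c j * ψ (k + j) * (starRingEnd ℂ) (l k) := by
    intro k _
    rw [← sum_mul, ← add_mul, ← hl]
  rw [sum_congr rfl hψv, sum_congr rfl hll, sum_add_distrib, sum_add_distrib,
    sum_Icc_sum_Icc_sub_one_eq n
      fun k j => ((j : ℂ) + 1) * c j * ψ (k + j) * (starRingEnd ℂ) (l k)]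
end

section
/- Let p₁, p₂, p₃ : ℝ → ℂ and let c₁, c₂, c₃, ψ̄₁, ψ̄₂, ψ̄₃ : ℝ → ℂ be differentiable functions satisfying, for all t ∈ ℝ, the Löwner–Kufarev Hamiltonian system: ċ₁ = −e^{−t}p₁, ċ₂ = −2e^{−t}p₁c₁ − e^{−2t}p₂, ċ₃ = −e^{−t}p₁(2c₂ + c₁²) − 3e^{−2t}p₂c₁ − e^{−3t}p₃, together with ψ̄̇₁ = 2e^{−t}p₁ψ̄₂ + (2e^{−t}p₁c₁ + 3e^{−2t}p₂)ψ̄₃, ψ̄̇₂ = 2e^{−t}p₁ψ̄₃, ψ̄̇₃ = 0. Then the covariant Kirillov fields L₁ = ψ̄₁ + 2c₁ψ̄₂ + 3c₂ψ̄₃, L₂ = ψ̄₂ + 2c₁ψ̄₃, and L₃ = ψ̄₃ are conserved: each of these three functions of t is constant. -/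
/-- **The covariant Kirillov fields are conserved by the Löwner–Kufarev ODE on `𝓜₃`.**
For the Löwner–Kufarev Hamiltonian system on the coefficient body `𝓜₃`, with driving
coefficients `p₁, p₂, p₃`, the covariant Kirillov fields
`L₁ = ψ̄₁ + 2c₁ψ̄₂ + 3c₂ψ̄₃`, `L₂ = ψ̄₂ + 2c₁ψ̄₃`, `L₃ = ψ̄₃` are constant in `t`. -/
theorem kirillov_conserved_LK
    (p₁ p₂ p₃ c₁ c₂ c₃ ψ₁ ψ₂ ψ₃ : ℝ → ℂ)
    (hc₁ : ∀ t : ℝ, HasDerivAt c₁ (-Complex.exp (-(t : ℂ)) * p₁ t) t)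
    (hc₂ : ∀ t : ℝ, HasDerivAt c₂
      (-2 * Complex.exp (-(t : ℂ)) * p₁ t * c₁ t - Complex.exp (-2 * (t : ℂ)) * p₂ t) t)
    (hc₃ : ∀ t : ℝ, HasDerivAt c₃
      (-Complex.exp (-(t : ℂ)) * p₁ t * (2 * c₂ t + c₁ t ^ 2)
        - 3 * Complex.exp (-2 * (t : ℂ)) * p₂ t * c₁ t
        - Complex.exp (-3 * (t : ℂ)) * p₃ t) t)
    (hψ₁ : ∀ t : ℝ, HasDerivAt ψ₁
      (2 * Complex.exp (-(t : ℂ)) * p₁ t * ψ₂ t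
        + (2 * Complex.exp (-(t : ℂ)) * p₁ t * c₁ t
            + 3 * Complex.exp (-2 * (t : ℂ)) * p₂ t) * ψ₃ t) t)
    (hψ₂ : ∀ t : ℝ, HasDerivAt ψ₂ (2 * Complex.exp (-(t : ℂ)) * p₁ t * ψ₃ t) t)
    (hψ₃ : ∀ t : ℝ, HasDerivAt ψ₃ 0 t) :
    ∀ t : ℝ,
      (ψ₁ t + 2 * c₁ t * ψ₂ t + 3 * c₂ t * ψ₃ t
        = ψ₁ 0 + 2 * c₁ 0 * ψ₂ 0 + 3 * c₂ 0 * ψ₃ 0) ∧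
      (ψ₂ t + 2 * c₁ t * ψ₃ t = ψ₂ 0 + 2 * c₁ 0 * ψ₃ 0) ∧
      (ψ₃ t = ψ₃ 0) := by
  have const_of_deriv {f : ℝ → ℂ} (hf : ∀ t, HasDerivAt f 0 t) (t : ℝ) : f t = f 0 :=
    is_const_of_deriv_eq_zero (fun t => (hf t).differentiableAt) (fun t => (hf t).deriv) t 0
  have hL₁ (t : ℝ) :
      HasDerivAt (fun t => ψ₁ t + 2 * c₁ t * ψ₂ t + 3 * c₂ t * ψ₃ t) 0 t := by
    refine (((hψ₁ t).fun_add (((hc₁ t).const_mul 2).fun_mul (hψ₂ t))).fun_add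
      (((hc₂ t).const_mul 3).fun_mul (hψ₃ t))).congr_deriv ?_
    ring
  have hL₂ (t : ℝ) : HasDerivAt (fun t => ψ₂ t + 2 * c₁ t * ψ₃ t) 0 t := by
    refine ((hψ₂ t).fun_add (((hc₁ t).const_mul 2).fun_mul (hψ₃ t))).congr_deriv ?_
    ring
  exact fun t => ⟨const_of_deriv hL₁ t, const_of_deriv hL₂ t, const_of_deriv hψ₃ t⟩
end

section
/- Regard c₁, c₂, … as indeterminates and define polynomials over ℂ: P₀ = 1, P_k = −Σ_{j=1}^{k} (j+1)·c_j·P_{k−j}; K₁ = 0, K_m = −Σ_{j=1}^{m−1} j·(m − j + 1)·c_{m−j}·c_j for m ≥ 2; and Π_m = m·c_m + Σ_{j=1}^{m} K_{m−j+1}·P_{j−1}. Then for every m ≥ 1 the polynomial identity m·c_m = Π_m + Σ_{j=1}^{m−1} (j+1)·c_j·Π_{m−j} holds; that is, the coefficients Π_m give the decomposition L₀ = Σ_{m≥1} Π_m·L_m of the field L₀ (with m-th affine component m·c_m) in the Kirillov basis L_k = ∂_k + Σ_j (j+1)·c_j·∂_{k+j}. -/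
open Finset MvPolynomial

theorem sum_Icc_one_eq_sum_range {M : Type*} [AddCommMonoid M] (f : ℕ → M) (n : ℕ) :
    ∑ j ∈ Icc 1 n, f j = ∑ i ∈ range n, f (i + 1) := by
  rw [range_eq_Ico, sum_Ico_add' f 0 n 1]
  rfl

theorem PowerSeries.coeff_mk_mul_mk {R : Type*} [Semiring R] (a b : ℕ → R) (n : ℕ) :
    PowerSeries.coeff n (PowerSeries.mk a * PowerSeries.mk b) =
      a 0 * b n + ∑ j ∈ Icc 1 n, a j * b (n - j) := by
  rw [PowerSeries.coeff_mul, Finset.Nat.sum_antidiagonal_eq_sum_range_succ_mk, sum_range_succ',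
    sum_Icc_one_eq_sum_range, add_comm]
  simp

/-- **Decomposition `L₀ = Σ_{m≥1} Π_m·L_m` in the Kirillov basis.**
All identities are between multivariate polynomials in the indeterminates `c₁, c₂, …`
(the variable of index `j ≥ 1` being `c_j`).  With `P₀ = 1`,
`P_k = −Σ_{j=1}^{k} (j+1)·c_j·P_{k−j}`, `K₁ = 0`,
`K_m = −Σ_{j=1}^{m−1} j·(m−j+1)·c_{m−j}·c_j`, and
`Π_m = m·c_m + Σ_{j=1}^{m} K_{m−j+1}·P_{j−1}`, the `m`-th affine component of
`Σ_k Π_k·L_k` equals that of `L₀`: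
`m·c_m = Π_m + Σ_{j=1}^{m−1} (j+1)·c_j·Π_{m−j}`. -/
theorem L0_decomposition_in_kirillov_basis
    (P K Pm : ℕ → MvPolynomial ℕ ℂ)
    (hP0 : P 0 = 1)
    (hP : ∀ k : ℕ, 1 ≤ k →
      P k = -∑ j ∈ Icc 1 k, C ((j : ℂ) + 1) * X j * P (k - j))
    (hK1 : K 1 = 0)
    (hK : ∀ m : ℕ, 2 ≤ m →
      K m = -∑ j ∈ Icc 1 (m - 1), C ((j : ℂ) * ((m - j + 1 : ℕ) : ℂ)) * X (m - j) * X j)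
    (hPm : ∀ m : ℕ, 1 ≤ m →
      Pm m = C (m : ℂ) * X m + ∑ j ∈ Icc 1 m, K (m - j + 1) * P (j - 1)) :
    ∀ m : ℕ, 1 ≤ m →
      C (m : ℂ) * X m = Pm m + ∑ j ∈ Icc 1 (m - 1), C ((j : ℂ) + 1) * X j * Pm (m - j) := by
  -- `F`, `D`, `k`, `Q` are the generating series of `(j+1)·c_j` (with constant
  -- term `1`), `m·c_m`, `K_m` and `Π_m`.
  set a : ℕ → MvPolynomial ℕ ℂ := fun j => if j = 0 then 1 else C ((j : ℂ) + 1) * X j with ha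
  set F := PowerSeries.mk a with hF
  set D := PowerSeries.mk (fun m : ℕ => (C (m : ℂ) * X m : MvPolynomial ℕ ℂ)) with hD
  set k := PowerSeries.mk (fun m => if m = 0 then 0 else K m) with hk
  set Q := PowerSeries.mk (fun m => if m = 0 then 0 else Pm m) with hQ
  have a_pos {j : ℕ} (hj : 1 ≤ j) : a j = C ((j : ℂ) + 1) * X j := if_neg (by omega)
  have F_mul_P : F * PowerSeries.mk P = 1 := by
    ext1 n
    rw [hF, PowerSeries.coeff_mk_mul_mk, PowerSeries.coeff_one]
    rcases Nat.eq_zero_or_pos n with rfl | hn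
    · simp [ha, hP0]
    · rw [if_neg hn.ne', hP n hn, show a 0 = 1 from if_pos rfl, one_mul, neg_add_eq_zero]
      exact sum_congr rfl fun j hj => by rw [a_pos (mem_Icc.1 hj).1]
  have D_mul_F : D * F = D - k := by
    ext1 n
    rw [hD, hF, PowerSeries.coeff_mk_mul_mk, map_sub, hk, PowerSeries.coeff_mk,
      PowerSeries.coeff_mk]
    obtain _ | n := n
    · simp
    · rw [sum_Icc_succ_top (by omega), if_neg (by omega)]
      have hKn : K (n + 1) = -∑ j ∈ Icc 1 n, C (j : ℂ) * X j * a (n + 1 - j) := by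
        obtain _ | n := n
        · simpa using hK1
        · rw [hK _ (by omega)]
          refine congrArg _ (sum_congr rfl fun j hj => ?_)
          have hj' := mem_Icc.1 hj
          rw [a_pos (by omega), C_mul, Nat.cast_add, Nat.cast_one]
          ring
      rw [hKn]
      simp [ha]
      ring
  have Q_eq : Q = D + PowerSeries.mk P * k := by
    ext1 n
    rw [hk, map_add, PowerSeries.coeff_mul, Finset.Nat.sum_antidiagonal_eq_sum_range_succ_mk,
      sum_range_succ, hQ, hD]
    simp only [PowerSeries.coeff_mk, Nat.sub_self, if_true, mul_zero, add_zero]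
    rcases Nat.eq_zero_or_pos n with rfl | hn
    · simp
    · rw [if_neg hn.ne', hPm n hn, sum_Icc_one_eq_sum_range]
      refine congrArg _ (sum_congr rfl fun i hi => ?_)
      have hi' := mem_range.1 hi
      rw [if_neg (by omega), show n - (i + 1) + 1 = n - i by omega, Nat.add_sub_cancel, mul_comm]
  have F_mul_Q : F * Q = D := by
    linear_combination F * Q_eq + k * F_mul_P + D_mul_F
  intro m hm
  have h := congrArg (PowerSeries.coeff m) F_mul_Q
  rw [hF, hQ, hD, PowerSeries.coeff_mk_mul_mk, PowerSeries.coeff_mk] at h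
  rw [← h]
  obtain ⟨n, rfl⟩ := Nat.exists_eq_add_of_le' hm
  rw [sum_Icc_succ_top (by omega), Nat.add_sub_cancel, Nat.sub_self, if_neg (by omega),
    if_pos rfl, mul_zero, add_zero]
  congr 1
  · simp [ha]
  · refine sum_congr rfl fun j hj => ?_
    have hj' := mem_Icc.1 hj
    rw [a_pos hj'.1, if_neg (by omega)]
end
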